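/- arXiv:1707.08093 — 2 statements merged into one kernel-verified Lean document; each statement's English description precedes it below -/
import Mathlib

section
/- Let P = (X, ≺) be a finite poset, let f : X → ℕ be a weight function taking non-negative integer values, and fix a real ε with 0 < ε < 1/|X|². Then P has an interval representation {I_x : x ∈ X} in which the length of I_x equals f(x) for every x ∈ X if and only if the weighted digraph G(P,f) has no negative-weight cycle. -/
open List

section Defs

variable {V : Type*}

/-- The arcs of a cycle given by the vertex list `l`: consecutive pairs, cyclically. -/
def cycleArcs (l : List V) : List (V × V) := l.zip (l.rotate 1)

/-- `l` is a cycle in the digraph with arc relation `E`: a nonempty list of distinct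
vertices such that each consecutive pair (cyclically) is an arc. -/
def IsCycle (E : V → V → Prop) (l : List V) : Prop :=
  l ≠ [] ∧ l.Nodup ∧ ∀ p ∈ cycleArcs l, E p.1 p.2

/-- The weight of the cycle given by vertex list `l`. -/
noncomputable def cycleWeight (w : V → V → ℝ) (l : List V) : ℝ :=
  ((cycleArcs l).map fun p => w p.1 p.2).sum

/-- `s` is a segment of the cycle `C`: a nonempty list of consecutively visited
vertices of `C` (possibly wrapping around once, so that a segment may traverse all
of `C` and return to its starting vertex). -/
def IsSegment (C s : List V) : Prop :=
  s ≠ [] ∧ s.length ≤ C.length + 1 ∧ ∃ i : ℕ, s = ((C.rotate i) ++ (C.rotate i)).take s.length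

/-- The weight of a segment: the sum of the weights of its consecutive arcs. -/
noncomputable def segWeight (w : V → V → ℝ) (s : List V) : ℝ :=
  ((s.zip s.tail).map fun p => w p.1 p.2).sum

variable {X : Type*} [PartialOrder X]

/-- `a` and `b` are incomparable points of the poset. -/
def Incomp (a b : X) : Prop := a ≠ b ∧ ¬ a < b ∧ ¬ b < a

/-- A point is co-simplicial if its incomparability set is an antichain. -/
def CoSimplicial (v : X) : Prop :=
  ∀ u w : X, Incomp u v → Incomp w v → u ≠ w → Incomp u w

/-- A poset is an interval order iff it has no induced 2+2. -/
def IsIntervalOrder (Y : Type*) [PartialOrder Y] : Prop :=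
  ¬ ∃ a b x y : Y, a < b ∧ x < y ∧ Incomp a x ∧ Incomp a y ∧ Incomp b x ∧ Incomp b y

/-- The arc relation of the digraphs `G(P,f)` and `G'(P,f)`: an arc `(a,b)` whenever
`a ≻ b` (a `(−)` arc) or `a` and `b` are incomparable (a `(+)` arc). -/
def GArc (a b : X) : Prop := b < a ∨ Incomp a b

-- Arc weights of `G'(P,f)`: the `(−)` arc `(a,b)` (for `a ≻ b`) has weight `−f(b)`;
-- the `(+)` arc `(a,b)` (for `a ∥ b`) has weight `f(a)`.
open Classical in
noncomputable def wG' (f : X → ℕ) (a b : X) : ℝ :=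
  if b < a then -(f b : ℝ) else (f a : ℝ)

-- Arc weights of `G(P,f)`: the `(−)` arc `(a,b)` (for `a ≻ b`) has weight `−f(b) − ε`;
-- the `(+)` arc `(a,b)` (for `a ∥ b`) has weight `f(a)`.
open Classical in
noncomputable def wG (f : X → ℕ) (ε : ℝ) (a b : X) : ℝ :=
  if b < a then -(f b : ℝ) - ε else (f a : ℝ)

/-- `L, R` give an interval representation of the poset: each `x` gets the closed
interval `[L x, R x]`, and `x ≺ y` iff the interval of `x` lies completely to the
left of the interval of `y`. -/
def IsIntervalRep (L R : X → ℝ) : Prop :=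
  (∀ x : X, L x ≤ R x) ∧ ∀ x y : X, x < y ↔ R x < L y

/-- The minimality hypothesis: `C` is a cycle of `G'(P,f)` of weight at most `0`
containing at least one `(−)` arc, with the minimum number of arcs among all such
cycles. -/
def MinHyp (f : X → ℕ) (C : List X) : Prop :=
  IsCycle GArc C ∧ cycleWeight (wG' f) C ≤ 0 ∧ (∃ p ∈ cycleArcs C, p.2 < p.1) ∧
    ∀ C' : List X, IsCycle GArc C' → cycleWeight (wG' f) C' ≤ 0 →
      (∃ p ∈ cycleArcs C', p.2 < p.1) → C.length ≤ C'.length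

/-- The points `a, b, c, d, e, x` induce a copy of one of the four posets in the
family ℋ: the comparabilities among them are exactly `a ≺ b ≺ c`, `d ≺ e`, `d ≺ c`,
`a ≺ e` (and `a ≺ c` by transitivity), together with one of the four combinations
obtained by choosing (`e ≺ c` or `e ∥ c`) and (`a ≺ d` or `a ∥ d`); all other pairs
are incomparable. -/
def HFamily (a b c d e x : X) : Prop :=
  a < b ∧ b < c ∧ d < e ∧ d < c ∧ a < e ∧
  Incomp a x ∧ Incomp b x ∧ Incomp c x ∧ Incomp d x ∧ Incomp e x ∧
  Incomp b d ∧ Incomp b e ∧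
  (e < c ∨ Incomp e c) ∧ (a < d ∨ Incomp a d)

end Defs

section Potential

variable {V : Type*}

theorem segWeight_cons_cons (w : V → V → ℝ) (x y : V) (l : List V) :
    segWeight w (x :: y :: l) = w x y + segWeight w (y :: l) := by
  simp [segWeight]

theorem segWeight_append (w : V → V → ℝ) (l₁ l₂ : List V) (a : V) :
    segWeight w (l₁ ++ a :: l₂) = segWeight w (l₁ ++ [a]) + segWeight w (a :: l₂) := by
  induction l₁ with
  | nil => simp [segWeight]
  | cons x t ih =>
    cases t with
    | nil => simp [segWeight]
    | cons y t =>
      simp only [List.cons_append, segWeight_cons_cons] at ih ⊢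
      rw [ih, add_assoc]

theorem zip_append_singleton (l m : List V) (c : V) (h : l.length = m.length) :
    (l ++ [c]).zip m = l.zip m := by
  rw [← List.append_nil m, List.zip_append h]
  simp

theorem cycleArcs_cons (b : V) (t : List V) :
    cycleArcs (b :: t) = (b :: t ++ [b]).zip (b :: t ++ [b]).tail := by
  rw [zip_append_singleton _ _ _ (by simp)]
  simp [cycleArcs]

theorem cycleWeight_cons (w : V → V → ℝ) (b : V) (t : List V) :
    cycleWeight w (b :: t) = segWeight w (b :: t ++ [b]) := by
  rw [cycleWeight, segWeight, cycleArcs_cons]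

theorem forall_mem_zip_tail_of_isChain {E : V → V → Prop} {l : List V} (h : l.IsChain E) :
    ∀ p ∈ l.zip l.tail, E p.1 p.2 := by
  induction h with
  | nil => simp
  | singleton => simp
  | cons_cons hab _ ih => simpa using ⟨hab, by simpa using ih⟩

/-- A finite weighted digraph without negative cycles admits a potential. -/
theorem exists_potential [Finite V] (E : V → V → Prop) (w : V → V → ℝ)
    (h : ∀ l, IsCycle E l → 0 ≤ cycleWeight w l) :
    ∃ p : V → ℝ, ∀ a b, E a b → p b - p a ≤ w a b := by
  have hfin : {l : List V | l.Nodup}.Finite := by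
    have := Fintype.ofFinite V
    classical
    exact Set.finite_coe_iff.mp (inferInstanceAs (Finite {l : List V // l.Nodup}))
  have hmin : ∀ v : V, ∃ l : List V, ((v :: l).Nodup ∧ (v :: l).IsChain E) ∧
      ∀ m : List V, (v :: m).Nodup → (v :: m).IsChain E →
        segWeight w (v :: l) ≤ segWeight w (v :: m) := by
    intro v
    have hS : {l : List V | (v :: l).Nodup ∧ (v :: l).IsChain E}.Finite :=
      hfin.subset fun l hl => (List.nodup_cons.mp hl.1).2
    obtain ⟨l, hl, hle⟩ := Set.exists_min_image _ (fun l => segWeight w (v :: l)) hS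
      ⟨[], by simp⟩
    exact ⟨l, hl, fun m h₁ h₂ => hle m ⟨h₁, h₂⟩⟩
  choose path hpath hle using hmin
  refine ⟨fun v => -segWeight w (v :: path v), fun a b hab => ?_⟩
  suffices segWeight w (a :: path a) ≤ w a b + segWeight w (b :: path b) by linarith
  obtain ⟨hnd, hch⟩ := hpath b
  by_cases ha : a ∈ b :: path b
  · obtain ⟨l₁, l₂, hl⟩ := List.append_of_mem ha
    rw [hl] at hnd hch ⊢
    rw [segWeight_append]
    have hshort := hle a l₂ hnd.of_append_right hch.right_of_append
    have hcycle : 0 ≤ segWeight w (l₁ ++ [a]) + w a b := by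
      obtain ⟨t, ht⟩ : ∃ t, l₁ ++ [a] = b :: t := by
        cases l₁ with
        | nil => exact ⟨[], by simp_all⟩
        | cons x s => exact ⟨s ++ [a], by simp_all⟩
      have hchain : (l₁ ++ [a, b]).IsChain E := by
        rw [List.isChain_split] at hch ⊢
        exact ⟨hch.1, by simpa using hab⟩
      have hcyc : IsCycle E (b :: t) := by
        refine ⟨by simp, ?_, ?_⟩
        · rw [← ht]
          exact hnd.sublist (by simp)
        · rw [cycleArcs_cons, ← ht]
          exact forall_mem_zip_tail_of_isChain (by simpa using hchain)
      have hw := h _ hcyc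
      rw [cycleWeight_cons, ← ht, List.append_assoc, List.singleton_append,
        segWeight_append] at hw
      simpa [segWeight] using hw
    linarith
  · rw [← segWeight_cons_cons]
    exact hle a _ (List.nodup_cons.mpr ⟨ha, hnd⟩) (List.isChain_cons_cons.mpr ⟨hab, hch⟩)

theorem sum_cycleArcs_sub (p : V → ℝ) (l : List V) :
    ((cycleArcs l).map fun e => p e.2 - p e.1).sum = 0 := by
  have key : ∀ l m : List V, l.length = m.length →
      ((l.zip m).map fun e => p e.2 - p e.1).sum = (m.map p).sum - (l.map p).sum := by
    intro l
    induction l with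
    | nil => intro m hm; cases m <;> simp_all
    | cons x l ih =>
      intro m hm
      cases m with
      | nil => simp at hm
      | cons y m =>
        simp only [List.zip_cons_cons, List.map_cons, List.sum_cons]
        rw [ih m (by simpa using hm)]
        ring
  rw [cycleArcs, key _ _ (by simp), ((List.rotate_perm l 1).map p).sum_eq, sub_self]

end Potential

section Weights

variable {X : Type*} [PartialOrder X]

theorem wG_eq_wG'_sub (f : X → ℕ) (ε : ℝ) {a b : X} (h : b < a) :
    wG f ε a b = wG' f a b - ε := by
  simp [wG, wG', h]

theorem wG_eq_wG' (f : X → ℕ) (ε : ℝ) {a b : X} (h : ¬ b < a) :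
    wG f ε a b = wG' f a b := by
  simp [wG, wG', h]

theorem exists_int_sum_wG' (f : X → ℕ) (l : List (X × X)) :
    ∃ k : ℤ, (l.map fun e => wG' f e.1 e.2).sum = k := by
  induction l with
  | nil => exact ⟨0, by simp⟩
  | cons e l ih =>
    obtain ⟨k, hk⟩ := ih
    rw [List.map_cons, List.sum_cons, hk, wG']
    split_ifs
    · exact ⟨-(f e.2) + k, by simp⟩
    · exact ⟨f e.1 + k, by simp⟩

theorem IsIntervalRep.sub_le_wG' {L R : X → ℝ} (hrep : IsIntervalRep L R) {f : X → ℕ}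
    (hlen : ∀ x, R x - L x = (f x : ℝ)) {a b : X} (hab : GArc a b) :
    L b - L a ≤ wG' f a b := by
  by_cases h : b < a
  · have := (hrep.2 b a).mp h
    have := hlen b
    simp only [wG', h, if_true]
    linarith
  · have hn : ¬ a < b := (hab.resolve_left h).2.1
    rw [hrep.2, not_lt] at hn
    have := hlen a
    simp only [wG', h, if_false]
    linarith

theorem IsIntervalRep.sub_lt_wG' {L R : X → ℝ} (hrep : IsIntervalRep L R) {f : X → ℕ}
    (hlen : ∀ x, R x - L x = (f x : ℝ)) {a b : X} (h : b < a) :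
    L b - L a < wG' f a b := by
  have := (hrep.2 b a).mp h
  have := hlen b
  simp only [wG', h, if_true]
  linarith

theorem IsIntervalRep.cycleWeight_wG_nonneg [Fintype X] {L R : X → ℝ}
    (hrep : IsIntervalRep L R) {f : X → ℕ} (hlen : ∀ x, R x - L x = (f x : ℝ)) {ε : ℝ}
    (hε0 : 0 ≤ ε) (hε1 : Fintype.card X * ε ≤ 1) {l : List X} (hl : IsCycle GArc l) :
    0 ≤ cycleWeight (wG f ε) l := by
  by_cases hm : ∃ e ∈ cycleArcs l, e.2 < e.1
  · obtain ⟨e, he, hlt⟩ := hm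
    have hpos : 0 < ((cycleArcs l).map fun e => wG' f e.1 e.2).sum := by
      rw [← sum_cycleArcs_sub L l]
      exact List.sum_lt_sum _ _ (fun e he => hrep.sub_le_wG' hlen (hl.2.2 e he))
        ⟨e, he, hrep.sub_lt_wG' hlen hlt⟩
    obtain ⟨k, hk⟩ := exists_int_sum_wG' f (cycleArcs l)
    have hone : (1 : ℝ) ≤ ((cycleArcs l).map fun e => wG' f e.1 e.2).sum := by
      rw [hk] at hpos ⊢
      exact_mod_cast hpos
    have hsub : ∀ s : List (X × X),
        (s.map fun e => wG' f e.1 e.2).sum - s.length * ε ≤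
          (s.map fun e => wG f ε e.1 e.2).sum := by
      intro s
      induction s with
      | nil => simp
      | cons e s ih =>
        have : wG' f e.1 e.2 - ε ≤ wG f ε e.1 e.2 := by
          by_cases h : e.2 < e.1
          · exact (wG_eq_wG'_sub f ε h).ge
          · rw [wG_eq_wG' f ε h]; linarith
        simp only [List.map_cons, List.sum_cons, List.length_cons, Nat.cast_add, Nat.cast_one]
        linarith
    have hcard : ((cycleArcs l).length : ℝ) ≤ Fintype.card X := by
      have : (cycleArcs l).length = l.length := by simp [cycleArcs]
      rw [this]
      exact_mod_cast hl.2.1.length_le_card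
    have := mul_le_mul_of_nonneg_right hcard hε0
    have := hsub (cycleArcs l)
    rw [cycleWeight]
    linarith
  · push Not at hm
    refine List.sum_nonneg fun x hx => ?_
    obtain ⟨e, he, rfl⟩ := List.mem_map.mp hx
    simp [wG, hm e he]

theorem isIntervalRep_of_sub_le_wG {f : X → ℕ} {ε : ℝ} (hε : 0 < ε) {p : X → ℝ}
    (hp : ∀ a b, GArc a b → p b - p a ≤ wG f ε a b) :
    IsIntervalRep p fun x => p x + f x := by
  have hlt : ∀ {x y : X}, x < y → p x + f x < p y := by
    intro x y hxy
    have := hp y x (Or.inl hxy)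
    simp only [wG, hxy, if_true] at this
    linarith
  have hself : ∀ x, p x ≤ p x + f x := fun x => by simp
  refine ⟨hself, fun x y => ⟨hlt, fun hxy => ?_⟩⟩
  by_contra hn
  by_cases hyx : y < x
  · linarith [hlt hyx, hself x, hself y]
  · by_cases heq : x = y
    · subst heq
      linarith [hself x]
    · have := hp x y (Or.inr ⟨heq, hn, hyx⟩)
      simp only [wG, hyx, if_false] at this
      linarith

end Weights

/-- `P` has an interval representation in which the interval of `x`
has length `f(x)` for every `x` iff `G(P,f)` has no negative-weight cycle. -/
theorem stmt_2 {X : Type*} [Fintype X] [PartialOrder X] (f : X → ℕ) (ε : ℝ)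
    (hε0 : 0 < ε) (hε1 : ε < 1 / (Fintype.card X : ℝ) ^ 2) :
    (∃ L R : X → ℝ, IsIntervalRep L R ∧ ∀ x : X, R x - L x = (f x : ℝ)) ↔
      ¬ ∃ l : List X, IsCycle GArc l ∧ cycleWeight (wG f ε) l < 0 := by
  constructor
  · rintro ⟨L, R, hrep, hlen⟩ ⟨l, hl, hneg⟩
    have hcard : (1 : ℝ) ≤ Fintype.card X := by
      have : 0 < Fintype.card X := Fintype.card_pos_iff.mpr ⟨l.head hl.1⟩
      exact_mod_cast this
    have hmul : Fintype.card X * ε ≤ 1 := by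
      rw [lt_div_iff₀ (by positivity)] at hε1
      nlinarith [mul_nonneg (mul_nonneg hε0.le (by positivity : (0 : ℝ) ≤ Fintype.card X))
        (sub_nonneg.mpr hcard)]
    exact hneg.not_ge (hrep.cycleWeight_wG_nonneg hlen hε0.le hmul hl)
  · intro h
    push Not at h
    obtain ⟨p, hp⟩ := exists_potential GArc (wG f ε) h
    exact ⟨p, fun x => p x + f x, isIntervalRep_of_sub_le_wG hε0 hp, fun x => by ring⟩
end

section
/- If a finite poset P has a {0,1}-interval representation, then P has a {0,1}-interval representation in which the interval assigned to x has length 0 for every co-simplicial point x, and length 1 for every point x that is not co-simplicial. -/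
open List

/-- A non-co-simplicial point has an interval of positive length in every representation. -/
lemma IsIntervalRep.lt_of_not_coSimplicial {X : Type*} [PartialOrder X] {L R : X → ℝ}
    (h : IsIntervalRep L R) {x : X} (hx : ¬ CoSimplicial x) : L x < R x := by
  have key : ∀ u w : X, Incomp u x → Incomp w x → u < w → L x < R x := by
    intro u w hu hw huw
    have h₁ := (h.2 u w).1 huw
    have h₂ := (h.2 u x).not.1 hu.2.1
    have h₃ := (h.2 x w).not.1 hw.2.2
    linarith
  by_contra hlt
  refine hx fun u w hu hw hne => ⟨hne, fun huw => ?_, fun hwu => ?_⟩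
  · exact hlt (key u w hu hw huw)
  · exact hlt (key w u hw hu hwu)

/-- Two distinct points incomparable to, or equal to, a co-simplicial point are incomparable. -/
lemma CoSimplicial.not_lt {X : Type*} [PartialOrder X] {x : X} (hx : CoSimplicial x) {y z : X}
    (hy : ¬ y < x ∧ ¬ x < y) (hz : ¬ z < x ∧ ¬ x < z) : ¬ y < z := by
  rcases eq_or_ne y x with rfl | hyx
  · exact hz.2
  rcases eq_or_ne z x with rfl | hzx
  · exact hy.1
  intro hlt
  exact (hx y z ⟨hyx, hy⟩ ⟨hzx, hz⟩ hlt.ne).2.1 hlt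

/-- if a finite poset has a {0,1}-interval representation, then it has
one in which every co-simplicial point gets an interval of length 0 and every
non-co-simplicial point gets an interval of length 1. -/
theorem stmt_4 {X : Type*} [Fintype X] [PartialOrder X]
    (h : ∃ L R : X → ℝ, IsIntervalRep L R ∧ ∀ x : X, R x - L x = 0 ∨ R x - L x = 1) :
    ∃ L R : X → ℝ, IsIntervalRep L R ∧
      (∀ x : X, CoSimplicial x → R x - L x = 0) ∧
      (∀ x : X, ¬ CoSimplicial x → R x - L x = 1) := by
  classical
  obtain ⟨L, R, hrep, hlen⟩ := h
  have hmax : ∀ x : X, ∃ m : X, (¬ m < x ∧ ¬ x < m) ∧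
      ∀ z : X, ¬ z < x ∧ ¬ x < z → L z ≤ L m := fun x =>
    Set.exists_max_image {z : X | ¬ z < x ∧ ¬ x < z} L (Set.toFinite _)
      ⟨x, lt_irrefl x, lt_irrefl x⟩
  choose m hm hLm using hmax
  have hmR : ∀ x : X, CoSimplicial x → ∀ y : X, ¬ y < x ∧ ¬ x < y → L (m x) ≤ R y :=
    fun x hx y hy => not_lt.1 ((hrep.2 y (m x)).not.1 (hx.not_lt hy (hm x)))
  have hself : ∀ x : X, ¬ x < x ∧ ¬ x < x := fun x => ⟨lt_irrefl x, lt_irrefl x⟩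
  have hm_le : ∀ x y : X, CoSimplicial x → ¬ y < x ∧ ¬ x < y → L (m x) ≤ L (m y) :=
    fun x y hx hy => hLm y _ ⟨hx.not_lt (hm x) hy, hx.not_lt hy (hm x)⟩
  let L' : X → ℝ := fun x => if CoSimplicial x then L (m x) else L x
  let R' : X → ℝ := fun x => if CoSimplicial x then L (m x) else R x
  have hLL : ∀ x, L x ≤ L' x := by
    intro x
    by_cases hx : CoSimplicial x
    · simpa [L', hx] using hLm x x (hself x)
    · simp [L', hx]
  have hRR : ∀ x, R' x ≤ R x := by
    intro x
    by_cases hx : CoSimplicial x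
    · simpa [R', hx] using hmR x hx x (hself x)
    · simp [R', hx]
  have hLR : ∀ x, L' x ≤ R' x := by
    intro x
    by_cases hx : CoSimplicial x
    · simp [L', R', hx]
    · simpa [L', R', hx] using hrep.1 x
  have hlt : ∀ x y : X, x < y → R' x < L' y := fun x y hxy =>
    (hRR x).trans_lt (((hrep.2 x y).1 hxy).trans_le (hLL y))
  refine ⟨L', R', ⟨hLR, fun x y => ⟨hlt x y, fun hxy => ?_⟩⟩, fun x hx => ?_, fun x hx => ?_⟩
  · by_contra hnlt
    by_cases hyx : y < x
    · linarith [hlt y x hyx, hLR x, hLR y]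
    refine hxy.not_ge ?_
    by_cases hx : CoSimplicial x <;> by_cases hy : CoSimplicial y <;> simp only [L', R', hx, hy,
      if_true, if_false]
    · exact hm_le y x hy ⟨hnlt, hyx⟩
    · exact hLm x y ⟨hyx, hnlt⟩
    · exact hmR y hy x ⟨hnlt, hyx⟩
    · exact not_lt.1 ((hrep.2 x y).not.1 hnlt)
  · simp [L', R', hx]
  · simpa [L', R', hx] using
      (hlen x).resolve_left (sub_pos.2 (hrep.lt_of_not_coSimplicial hx)).ne'
end
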